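/- Let $f:\mathbb{R}^d\to\mathbb{R}$ be convex, differentiable, and satisfy $\|\nabla f(u)-\nabla f(v)\| \le L_\alpha\|u-v\|^\alpha + L_1\|u-v\|$ for all $u,v$, with $\alpha\in[0,1]$, $L_\alpha,L_1\ge 0$. Fix $y,x^0\in\mathbb{R}^d$, $\eta>0$, $\mu\ge 0$, let $g_y^\eta(x)=f(x)+\frac{\mu}{2}\|x-x^0\|^2+\frac{1}{2\eta}\|x-y\|^2$ with minimizer $x^*$, and set $\eta_{\mu,L_1}=\eta/(1+\eta\mu+\eta L_1)$. Then for all $x\in\mathbb{R}^d$: $g_y^\eta(x) \le g_y^\eta(x^*) + \frac{L_\alpha}{\alpha+1}\|x-x^*\|^{\alpha+1} + \frac{1}{2\eta_{\mu,L_1}}\|x-x^*\|^2$. -/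

import Mathlib

open scoped RealInnerProductSpace in
theorem HasGradientAt.hasDerivAt_comp_line {E : Type*} [NormedAddCommGroup E]
    [InnerProductSpace ℝ E] [CompleteSpace E] {f : E → ℝ} {g z v : E} {t : ℝ}
    (h : HasGradientAt f g (z + t • v)) :
    HasDerivAt (fun s : ℝ => f (z + s • v)) ⟪g, v⟫ t := by
  have hline : HasDerivAt (fun s : ℝ => z + s • v) v t := by
    simpa using ((hasDerivAt_id t).smul_const v).const_add z
  simpa [Function.comp_def] using h.hasFDerivAt.comp_hasDerivAt t hline

open scoped RealInnerProductSpace in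
/-- Descent lemma for a gradient with a mixed Hölder and Lipschitz modulus of continuity at `z`. -/
theorem le_add_inner_add_of_norm_gradient_sub_le {E : Type*} [NormedAddCommGroup E]
    [InnerProductSpace ℝ E] [CompleteSpace E] {f : E → ℝ} {f' : E → E} {α A L : ℝ}
    (hα : 0 ≤ α) (hgrad : ∀ x, HasGradientAt f (f' x) x) {z : E}
    (h : ∀ u, ‖f' u - f' z‖ ≤ A * ‖u - z‖ ^ α + L * ‖u - z‖) (x : E) :
    f x ≤ f z + ⟪f' z, x - z⟫ + A / (α + 1) * ‖x - z‖ ^ (α + 1) + L / 2 * ‖x - z‖ ^ 2 := by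
  obtain ⟨v, rfl⟩ : ∃ v, x = z + v := ⟨x - z, by abel⟩
  have hφ (t : ℝ) := (hgrad (z + t • v)).hasDerivAt_comp_line
  have hB (t : ℝ) : HasDerivAt (fun s : ℝ => f z + s * ⟪f' z, v⟫ +
      A / (α + 1) * ‖v‖ ^ (α + 1) * s ^ (α + 1) + L / 2 * ‖v‖ ^ 2 * s ^ 2)
      (⟪f' z, v⟫ + A * ‖v‖ ^ (α + 1) * t ^ α + L * ‖v‖ ^ 2 * t) t := by
    have hpow := Real.hasDerivAt_rpow_const (x := t) (p := α + 1) (Or.inr (by linarith))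
    have hsum := ((((hasDerivAt_id t).mul_const ⟪f' z, v⟫).const_add (f z)).add
      (hpow.const_mul (A / (α + 1) * ‖v‖ ^ (α + 1)))).add
      ((hasDerivAt_pow 2 t).const_mul (L / 2 * ‖v‖ ^ 2))
    refine hsum.congr_deriv ?_
    rw [add_sub_cancel_right]
    field_simp
    push_cast
    ring
  have key := image_le_of_deriv_right_le_deriv_boundary (a := 0) (b := 1)
    (fun t _ => (hφ t).continuousAt.continuousWithinAt) (fun t _ => (hφ t).hasDerivWithinAt)
    (by simp [Real.zero_rpow (show α + 1 ≠ 0 by linarith)])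
    (fun t _ => (hB t).continuousAt.continuousWithinAt) (fun t _ => (hB t).hasDerivWithinAt)
    (fun t ht => by
      have hinner : ⟪f' (z + t • v) - f' z, v⟫ ≤
          (A * ‖t • v‖ ^ α + L * ‖t • v‖) * ‖v‖ := by
        refine (real_inner_le_norm _ _).trans ?_
        gcongr
        simpa using h (z + t • v)
      rw [inner_sub_left, norm_smul, Real.norm_of_nonneg ht.1,
        Real.mul_rpow ht.1 (norm_nonneg v)] at hinner
      rw [Real.rpow_add_one' (norm_nonneg v) (by linarith)]
      linarith)
    (Set.right_mem_Icc.2 zero_le_one)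
  simpa using key

theorem norm_add_smul_sub_sq {E : Type*} [NormedAddCommGroup E] [InnerProductSpace ℝ E]
    (z v w : E) (t : ℝ) :
    ‖z + t • v - w‖ ^ 2 = ‖z - w‖ ^ 2 + 2 * t * inner ℝ (z - w) v + t ^ 2 * ‖v‖ ^ 2 := by
  rw [add_sub_right_comm, norm_add_sq_real, inner_smul_right, norm_smul, mul_pow,
    Real.norm_eq_abs, sq_abs]
  ring


theorem stmt_8 (d : ℕ) (f : EuclideanSpace ℝ (Fin d) → ℝ)
    (f' : EuclideanSpace ℝ (Fin d) → EuclideanSpace ℝ (Fin d))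
    (α Lα L1 η μ : ℝ) (hα0 : 0 ≤ α) (hα1 : α ≤ 1) (hLα : 0 ≤ Lα) (hL1 : 0 ≤ L1)
    (hη : 0 < η) (hμ : 0 ≤ μ)
    (y x0 xstar : EuclideanSpace ℝ (Fin d))
    (hconv : ConvexOn ℝ Set.univ f)
    (hgrad : ∀ x, HasGradientAt f (f' x) x)
    (hss : ∀ u v, ‖f' u - f' v‖ ≤ Lα * ‖u - v‖ ^ α + L1 * ‖u - v‖)
    (gyη : EuclideanSpace ℝ (Fin d) → ℝ)
    (hgyη : ∀ x, gyη x = f x + μ / 2 * ‖x - x0‖ ^ 2 + 1 / (2 * η) * ‖x - y‖ ^ 2)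
    (ημL1 : ℝ) (hημL1 : ημL1 = η / (1 + η * μ + η * L1))
    (hmin : ∀ x, gyη xstar ≤ gyη x) :
    ∀ x, gyη x ≤ gyη xstar + Lα / (α + 1) * ‖x - xstar‖ ^ (α + 1) +
      1 / (2 * ημL1) * ‖x - xstar‖ ^ 2 := by
  intro x
  obtain ⟨v, rfl⟩ : ∃ v, x = xstar + v := ⟨x - xstar, by abel⟩
  have hderiv : HasDerivAt (fun t : ℝ => gyη (xstar + t • v))
      (inner ℝ (f' xstar) v + μ * inner ℝ (xstar - x0) v + 1 / η * inner ℝ (xstar - y) v) 0 := by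
    have hquad (w : EuclideanSpace ℝ (Fin d)) : HasDerivAt
        (fun t : ℝ => ‖xstar + t • v - w‖ ^ 2) (2 * inner ℝ (xstar - w) v) 0 := by
      simp only [norm_add_smul_sub_sq]
      have hlin := ((hasDerivAt_id (0 : ℝ)).const_mul 2).mul_const (inner ℝ (xstar - w) v)
      have hsq := (hasDerivAt_pow 2 (0 : ℝ)).mul_const (‖v‖ ^ 2)
      exact ((hlin.const_add (‖xstar - w‖ ^ 2)).add hsq).congr_deriv (by simp)
    simp only [hgyη]
    have hf := (hgrad (xstar + (0 : ℝ) • v)).hasDerivAt_comp_line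
    refine ((hf.add ((hquad x0).const_mul (μ / 2))).add
      ((hquad y).const_mul (1 / (2 * η)))).congr_deriv ?_
    simp only [zero_smul, add_zero]
    field_simp
  have hstat := IsLocalMin.hasDerivAt_eq_zero
    (Filter.Eventually.of_forall fun t => by simpa using hmin (xstar + t • v)) hderiv
  have hdesc := le_add_inner_add_of_norm_gradient_sub_le hα0 hgrad
    (fun u => hss u xstar) (xstar + v)
  have hx0 := norm_add_smul_sub_sq xstar v x0 1
  have hy := norm_add_smul_sub_sq xstar v y 1
  have hcoef : 1 / (2 * ημL1) = 1 / (2 * η) + μ / 2 + L1 / 2 := by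
    rw [hημL1]
    field_simp
  rw [one_smul] at hx0 hy
  rw [add_sub_cancel_left] at hdesc ⊢
  rw [hgyη, hgyη, hcoef, hx0, hy]
  have hη2 : 1 / η = 2 * (1 / (2 * η)) := by field_simp
  rw [hη2] at hstat
  linarith
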